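/- arXiv:2512.23172 — 5 statements merged into one kernel-verified Lean document; each statement's English description precedes it below -/
import Mathlib

section
/- The function F has exactly one critical point on its domain {z ∈ ℝ² : z₂ > 0, z ≠ e₂}, namely z₀ = (0, α) with α = (2Λ₁ + √(4Λ₁² + Λ₂²))/Λ₂. Moreover ∂²F/∂z₁²(z₀) > 0, ∂²F/∂z₂²(z₀) < 0 and ∂²F/∂z₁∂z₂(z₀) = 0; in particular z₀ is a nondegenerate critical point of F, with det ∇²F(z₀) < 0. -/
open Real

noncomputable section

def e2 : EuclideanSpace ℝ (Fin 2) := EuclideanSpace.single (1 : Fin 2) (1 : ℝ)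

/-- `F(z) = -(1/(2π)) (Λ₂ log z₂ + 2Λ₁ log(|z+e₂|/|z−e₂|))`. -/
def Ffun (Λ₁ Λ₂ : ℝ) (z : EuclideanSpace ℝ (Fin 2)) : ℝ :=
  -(1 / (2 * π)) * (Λ₂ * Real.log (z 1) + 2 * Λ₁ * Real.log (‖z + e2‖ / ‖z - e2‖))

/-- Second partial derivative `∂²F/∂z_i∂z_j` at `z`. -/
def d2F (Λ₁ Λ₂ : ℝ) (z : EuclideanSpace ℝ (Fin 2)) (i j : Fin 2) : ℝ :=
  fderiv ℝ (fun w => fderiv ℝ (Ffun Λ₁ Λ₂) w (EuclideanSpace.single j (1 : ℝ))) z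
    (EuclideanSpace.single i (1 : ℝ))

/-- The squared distance from `z` to the point `(0, s)`. -/
def sqDist (s : ℝ) (z : EuclideanSpace ℝ (Fin 2)) : ℝ := z 0 ^ 2 + (z 1 - s) ^ 2

lemma sqDist_eq_norm_sq (s : ℝ) (z : EuclideanSpace ℝ (Fin 2)) :
    sqDist s z = ‖z - EuclideanSpace.single 1 s‖ ^ 2 := by
  simp [sqDist, EuclideanSpace.norm_sq_eq, Fin.sum_univ_two]

lemma sqDist_one_pos {z : EuclideanSpace ℝ (Fin 2)} (hz : z ≠ e2) : 0 < sqDist 1 z := by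
  rw [sqDist_eq_norm_sq]
  exact pow_pos (norm_pos_iff.2 (sub_ne_zero.2 hz)) 2

lemma sqDist_neg_one_pos {z : EuclideanSpace ℝ (Fin 2)} (hz : 0 < z 1) :
    0 < sqDist (-1) z := by
  unfold sqDist
  nlinarith [sq_nonneg (z 0), sq_nonneg (z 1)]

lemma hasFDerivAt_apply_euclidean (i : Fin 2) (z : EuclideanSpace ℝ (Fin 2)) :
    HasFDerivAt (fun w : EuclideanSpace ℝ (Fin 2) => w i)
      (EuclideanSpace.proj i : EuclideanSpace ℝ (Fin 2) →L[ℝ] ℝ) z :=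
  (EuclideanSpace.proj i : EuclideanSpace ℝ (Fin 2) →L[ℝ] ℝ).hasFDerivAt

lemma hasFDerivAt_sqDist (s : ℝ) (z : EuclideanSpace ℝ (Fin 2)) :
    HasFDerivAt (sqDist s)
      ((2 * z 0) • (EuclideanSpace.proj 0 : EuclideanSpace ℝ (Fin 2) →L[ℝ] ℝ) +
        (2 * (z 1 - s)) • (EuclideanSpace.proj 1 : EuclideanSpace ℝ (Fin 2) →L[ℝ] ℝ)) z := by
  have h := ((hasFDerivAt_apply_euclidean 0 z).pow 2).add
    (((hasFDerivAt_apply_euclidean 1 z).sub_const s).pow 2)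
  refine HasFDerivAt.congr_fderiv h ?_
  simp

lemma HasFDerivAt.inv_real {E : Type*} [NormedAddCommGroup E] [NormedSpace ℝ E] {f : E → ℝ}
    {f' : E →L[ℝ] ℝ} {x : E} (hf : HasFDerivAt f f' x) (hx : f x ≠ 0) :
    HasFDerivAt (fun y => (f y)⁻¹) (-(f x ^ 2)⁻¹ • f') x :=
  (hasDerivAt_inv hx).comp_hasFDerivAt x hf

lemma Ffun_eq (Λ₁ Λ₂ : ℝ) {z : EuclideanSpace ℝ (Fin 2)} (hz : 0 < z 1) (hz' : z ≠ e2) :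
    Ffun Λ₁ Λ₂ z = -(1 / (2 * π)) *
      (Λ₂ * Real.log (z 1) + Λ₁ * (Real.log (sqDist (-1) z) - Real.log (sqDist 1 z))) := by
  have hP := sqDist_neg_one_pos hz
  have hQ := sqDist_one_pos hz'
  have hp : sqDist (-1) z = ‖z + e2‖ ^ 2 := by
    simp [sqDist, e2, EuclideanSpace.norm_sq_eq, Fin.sum_univ_two]
  have hq : sqDist 1 z = ‖z - e2‖ ^ 2 := sqDist_eq_norm_sq 1 z
  rw [hp] at hP ⊢
  rw [hq] at hQ ⊢
  rw [Ffun, Real.log_div (by rintro h; simp [h] at hP) (by rintro h; simp [h] at hQ),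
    Real.log_pow, Real.log_pow]
  push_cast
  ring

/-- The first partial derivative `∂F/∂z₁`. -/
def gradFst (Λ₁ : ℝ) (z : EuclideanSpace ℝ (Fin 2)) : ℝ :=
  -(1 / (2 * π)) * (Λ₁ * (2 * z 0 * ((sqDist (-1) z)⁻¹ - (sqDist 1 z)⁻¹)))

/-- The first partial derivative `∂F/∂z₂`. -/
def gradSnd (Λ₁ Λ₂ : ℝ) (z : EuclideanSpace ℝ (Fin 2)) : ℝ :=
  -(1 / (2 * π)) * (Λ₂ * (z 1)⁻¹ +
    Λ₁ * (2 * (z 1 - -1) * (sqDist (-1) z)⁻¹ - 2 * (z 1 - 1) * (sqDist 1 z)⁻¹))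

lemma eventually_mem_domain {z : EuclideanSpace ℝ (Fin 2)} (hz : 0 < z 1) (hz' : z ≠ e2) :
    ∀ᶠ w in nhds z, 0 < w 1 ∧ w ≠ e2 :=
  ((hasFDerivAt_apply_euclidean 1 z).continuousAt.eventually (lt_mem_nhds hz)).and
    (isOpen_ne.mem_nhds hz')

lemma hasFDerivAt_Ffun (Λ₁ Λ₂ : ℝ) {z : EuclideanSpace ℝ (Fin 2)} (hz : 0 < z 1)
    (hz' : z ≠ e2) :
    HasFDerivAt (Ffun Λ₁ Λ₂)
      (gradFst Λ₁ z • (EuclideanSpace.proj 0 : EuclideanSpace ℝ (Fin 2) →L[ℝ] ℝ) +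
        gradSnd Λ₁ Λ₂ z • (EuclideanSpace.proj 1 : EuclideanSpace ℝ (Fin 2) →L[ℝ] ℝ)) z := by
  have hP := (sqDist_neg_one_pos hz).ne'
  have hQ := (sqDist_one_pos hz').ne'
  have h := ((((hasFDerivAt_apply_euclidean 1 z).log hz.ne').const_mul Λ₂).add
    ((((hasFDerivAt_sqDist (-1) z).log hP).sub
      ((hasFDerivAt_sqDist 1 z).log hQ)).const_mul Λ₁)).const_mul (-(1 / (2 * π)))
  refine HasFDerivAt.congr_of_eventuallyEq (HasFDerivAt.congr_fderiv h ?_) ?_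
  · ext v
    simp [gradFst, gradSnd]
    ring
  · filter_upwards [eventually_mem_domain hz hz'] with w hw
    exact Ffun_eq Λ₁ Λ₂ hw.1 hw.2

lemma fderiv_Ffun_eq_zero_iff (Λ₁ Λ₂ : ℝ) {z : EuclideanSpace ℝ (Fin 2)} (hz : 0 < z 1)
    (hz' : z ≠ e2) :
    fderiv ℝ (Ffun Λ₁ Λ₂) z = 0 ↔ gradFst Λ₁ z = 0 ∧ gradSnd Λ₁ Λ₂ z = 0 := by
  rw [(hasFDerivAt_Ffun Λ₁ Λ₂ hz hz').fderiv]
  constructor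
  · intro h
    have h0 := DFunLike.congr_fun h (EuclideanSpace.single 0 1)
    have h1 := DFunLike.congr_fun h (EuclideanSpace.single 1 1)
    exact ⟨by simpa using h0, by simpa using h1⟩
  · rintro ⟨h0, h1⟩
    simp [h0, h1]

lemma d2F_eq_fst (Λ₁ Λ₂ : ℝ) {z : EuclideanSpace ℝ (Fin 2)} (hz : 0 < z 1) (hz' : z ≠ e2)
    (i : Fin 2) :
    d2F Λ₁ Λ₂ z i 0 = fderiv ℝ (gradFst Λ₁) z (EuclideanSpace.single i 1) := by
  rw [d2F, Filter.EventuallyEq.fderiv_eq]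
  filter_upwards [eventually_mem_domain hz hz'] with w hw
  simp [(hasFDerivAt_Ffun Λ₁ Λ₂ hw.1 hw.2).fderiv]

lemma d2F_eq_snd (Λ₁ Λ₂ : ℝ) {z : EuclideanSpace ℝ (Fin 2)} (hz : 0 < z 1) (hz' : z ≠ e2)
    (i : Fin 2) :
    d2F Λ₁ Λ₂ z i 1 = fderiv ℝ (gradSnd Λ₁ Λ₂) z (EuclideanSpace.single i 1) := by
  rw [d2F, Filter.EventuallyEq.fderiv_eq]
  filter_upwards [eventually_mem_domain hz hz'] with w hw
  simp [(hasFDerivAt_Ffun Λ₁ Λ₂ hw.1 hw.2).fderiv]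

lemma sqDist_single (s a : ℝ) : sqDist s (EuclideanSpace.single 1 a) = (a - s) ^ 2 := by
  simp [sqDist]

lemma hasFDerivAt_gradFst_single (Λ₁ : ℝ) {a : ℝ} (ha : 1 < a) :
    HasFDerivAt (gradFst Λ₁)
      ((-(1 / (2 * π)) * (Λ₁ * (2 * (((a + 1) ^ 2)⁻¹ - ((a - 1) ^ 2)⁻¹)))) •
        (EuclideanSpace.proj 0 : EuclideanSpace ℝ (Fin 2) →L[ℝ] ℝ))
      (EuclideanSpace.single 1 a) := by
  have hP : sqDist (-1) (EuclideanSpace.single 1 a) ≠ 0 := by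
    rw [sqDist_single]; exact pow_ne_zero 2 (by linarith)
  have hQ : sqDist 1 (EuclideanSpace.single 1 a) ≠ 0 := by
    rw [sqDist_single]; exact pow_ne_zero 2 (by linarith)
  have h := (((((hasFDerivAt_apply_euclidean 0 (EuclideanSpace.single 1 a)).const_mul 2).mul
    (((hasFDerivAt_sqDist (-1) _).inv_real hP).sub
      ((hasFDerivAt_sqDist 1 _).inv_real hQ))).const_mul Λ₁)).const_mul (-(1 / (2 * π)))
  refine HasFDerivAt.congr_fderiv h ?_
  ext v
  simp [sqDist_single]
  ring

lemma hasFDerivAt_gradSnd_single (Λ₁ Λ₂ : ℝ) {a : ℝ} (ha : 1 < a) :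
    HasFDerivAt (gradSnd Λ₁ Λ₂)
      ((-(1 / (2 * π)) * (-Λ₂ * (a ^ 2)⁻¹ +
          Λ₁ * (2 * (((a - 1) ^ 2)⁻¹ - ((a + 1) ^ 2)⁻¹)))) •
        (EuclideanSpace.proj 1 : EuclideanSpace ℝ (Fin 2) →L[ℝ] ℝ))
      (EuclideanSpace.single 1 a) := by
  have hP : sqDist (-1) (EuclideanSpace.single 1 a) ≠ 0 := by
    rw [sqDist_single]; exact pow_ne_zero 2 (by linarith)
  have hQ : sqDist 1 (EuclideanSpace.single 1 a) ≠ 0 := by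
    rw [sqDist_single]; exact pow_ne_zero 2 (by linarith)
  have hy : (EuclideanSpace.single 1 a : EuclideanSpace ℝ (Fin 2)) 1 ≠ 0 := by
    simp; linarith
  have hd := hasFDerivAt_apply_euclidean 1 (EuclideanSpace.single 1 a)
  have h := (((hd.inv_real hy).const_mul Λ₂).add
    (((((hd.sub_const (-1)).const_mul 2).mul ((hasFDerivAt_sqDist (-1) _).inv_real hP)).sub
      (((hd.sub_const 1).const_mul 2).mul
        ((hasFDerivAt_sqDist 1 _).inv_real hQ))).const_mul Λ₁)).const_mul (-(1 / (2 * π)))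
  refine HasFDerivAt.congr_fderiv h ?_
  have h1 : a + 1 ≠ 0 := by linarith
  have h2 : a - 1 ≠ 0 := by linarith
  have h3 : a ≠ 0 := by linarith
  ext v
  simp [sqDist_single]
  field_simp
  ring

lemma gradFst_eq_zero_iff {Λ₁ : ℝ} (hΛ₁ : 0 < Λ₁) {z : EuclideanSpace ℝ (Fin 2)}
    (hz : 0 < z 1) (hz' : z ≠ e2) : gradFst Λ₁ z = 0 ↔ z 0 = 0 := by
  have hP := sqDist_neg_one_pos hz
  have hQ := sqDist_one_pos hz'
  have hne : (sqDist (-1) z)⁻¹ - (sqDist 1 z)⁻¹ ≠ 0 := by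
    refine sub_ne_zero.2 fun h => ?_
    have := inv_injective h
    simp only [sqDist] at this
    nlinarith
  simp [gradFst, hne, hΛ₁.ne', Real.pi_ne_zero]

lemma gradSnd_eq_zero_iff (Λ₁ Λ₂ : ℝ) {z : EuclideanSpace ℝ (Fin 2)} (hz : 0 < z 1)
    (hz' : z ≠ e2) (h0 : z 0 = 0) :
    gradSnd Λ₁ Λ₂ z = 0 ↔ Λ₂ * (z 1 ^ 2 - 1) = 4 * Λ₁ * z 1 := by
  have hQ := sqDist_one_pos hz'
  have h1 : z 1 - 1 ≠ 0 := by
    intro h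
    simp [sqDist, h0, h] at hQ
  have h2 : z 1 + 1 ≠ 0 := by linarith
  have key : gradSnd Λ₁ Λ₂ z = -(1 / (2 * π)) *
      ((Λ₂ * (z 1 ^ 2 - 1) - 4 * Λ₁ * z 1) / (z 1 * ((z 1 - 1) * (z 1 + 1)))) := by
    simp only [gradSnd, sqDist, h0, sub_neg_eq_add]
    field_simp
    ring
  rw [key]
  simp [h1, h2, hz.ne', Real.pi_ne_zero, sub_eq_zero]

lemma quadratic_eq_iff {Λ₁ Λ₂ : ℝ} (hΛ₁ : 0 < Λ₁) (hΛ₂ : 0 < Λ₂) {y : ℝ} (hy : 0 < y) :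
    Λ₂ * (y ^ 2 - 1) = 4 * Λ₁ * y ↔
      y = (2 * Λ₁ + Real.sqrt (4 * Λ₁ ^ 2 + Λ₂ ^ 2)) / Λ₂ := by
  have hs : Real.sqrt (4 * Λ₁ ^ 2 + Λ₂ ^ 2) ^ 2 = 4 * Λ₁ ^ 2 + Λ₂ ^ 2 :=
    Real.sq_sqrt (by positivity)
  rw [eq_div_iff hΛ₂.ne']
  constructor
  · intro h
    have hsq : (Λ₂ * y - 2 * Λ₁) ^ 2 = 4 * Λ₁ ^ 2 + Λ₂ ^ 2 := by linear_combination Λ₂ * h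
    have hpos : 0 ≤ Λ₂ * y - 2 * Λ₁ := by
      have : 0 < (Λ₂ * y - 4 * Λ₁) * y := by linarith
      have := pos_of_mul_pos_left this hy.le
      linarith
    rw [← hsq, Real.sqrt_sq hpos]
    ring
  · intro h
    have : Real.sqrt (4 * Λ₁ ^ 2 + Λ₂ ^ 2) = Λ₂ * y - 2 * Λ₁ := by linarith
    rw [this] at hs
    refine mul_left_cancel₀ hΛ₂.ne' ?_
    linear_combination hs

lemma one_lt_root {Λ₁ Λ₂ : ℝ} (hΛ₁ : 0 < Λ₁) (hΛ₂ : 0 < Λ₂) :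
    1 < (2 * Λ₁ + Real.sqrt (4 * Λ₁ ^ 2 + Λ₂ ^ 2)) / Λ₂ := by
  rw [one_lt_div hΛ₂]
  have : Λ₂ ≤ Real.sqrt (4 * Λ₁ ^ 2 + Λ₂ ^ 2) := Real.le_sqrt_of_sq_le (by nlinarith)
  linarith

theorem stmt_4 (Λ₁ Λ₂ : ℝ) (hΛ₁ : 0 < Λ₁) (hΛ₂ : 0 < Λ₂) :
    -- the unique critical point is z₀ = (0, α)
    (∀ z : EuclideanSpace ℝ (Fin 2), 0 < z 1 → z ≠ e2 →
      (fderiv ℝ (Ffun Λ₁ Λ₂) z = 0 ↔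
        z = EuclideanSpace.single (1 : Fin 2)
          ((2 * Λ₁ + Real.sqrt (4 * Λ₁ ^ 2 + Λ₂ ^ 2)) / Λ₂))) ∧
    fderiv ℝ (Ffun Λ₁ Λ₂)
      (EuclideanSpace.single (1 : Fin 2)
        ((2 * Λ₁ + Real.sqrt (4 * Λ₁ ^ 2 + Λ₂ ^ 2)) / Λ₂)) = 0 ∧
    -- second derivatives at z₀
    0 < d2F Λ₁ Λ₂ (EuclideanSpace.single (1 : Fin 2)
        ((2 * Λ₁ + Real.sqrt (4 * Λ₁ ^ 2 + Λ₂ ^ 2)) / Λ₂)) 0 0 ∧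
    d2F Λ₁ Λ₂ (EuclideanSpace.single (1 : Fin 2)
        ((2 * Λ₁ + Real.sqrt (4 * Λ₁ ^ 2 + Λ₂ ^ 2)) / Λ₂)) 1 1 < 0 ∧
    d2F Λ₁ Λ₂ (EuclideanSpace.single (1 : Fin 2)
        ((2 * Λ₁ + Real.sqrt (4 * Λ₁ ^ 2 + Λ₂ ^ 2)) / Λ₂)) 0 1 = 0 ∧
    (Matrix.of fun i j : Fin 2 =>
      d2F Λ₁ Λ₂ (EuclideanSpace.single (1 : Fin 2)
        ((2 * Λ₁ + Real.sqrt (4 * Λ₁ ^ 2 + Λ₂ ^ 2)) / Λ₂)) i j).det < 0 := by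
  have ha := one_lt_root hΛ₁ hΛ₂
  have hroot := fun {y : ℝ} => quadratic_eq_iff (y := y) hΛ₁ hΛ₂
  set a := (2 * Λ₁ + Real.sqrt (4 * Λ₁ ^ 2 + Λ₂ ^ 2)) / Λ₂
  have hcrit : ∀ z : EuclideanSpace ℝ (Fin 2), 0 < z 1 → z ≠ e2 →
      (fderiv ℝ (Ffun Λ₁ Λ₂) z = 0 ↔ z = EuclideanSpace.single 1 a) := by
    intro z hz hz'
    rw [fderiv_Ffun_eq_zero_iff Λ₁ Λ₂ hz hz', gradFst_eq_zero_iff hΛ₁ hz hz']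
    constructor
    · rintro ⟨h0, h1⟩
      rw [gradSnd_eq_zero_iff Λ₁ Λ₂ hz hz' h0, hroot hz] at h1
      ext i
      fin_cases i <;> simp [h0, h1]
    · intro h
      have h0 : z 0 = 0 := by simp [h]
      rw [gradSnd_eq_zero_iff Λ₁ Λ₂ hz hz' h0, hroot hz]
      exact ⟨h0, by simp [h]⟩
  have hz : 0 < (EuclideanSpace.single 1 a : EuclideanSpace ℝ (Fin 2)) 1 := by
    simp; linarith
  have hz' : (EuclideanSpace.single 1 a : EuclideanSpace ℝ (Fin 2)) ≠ e2 := by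
    intro h
    have := congrArg (fun w : EuclideanSpace ℝ (Fin 2) => w 1) h
    simp [e2] at this
    linarith
  have hc : 0 < 1 / (2 * π) := by positivity
  have hinv : ((a + 1) ^ 2)⁻¹ < ((a - 1) ^ 2)⁻¹ :=
    inv_strictAnti₀ (pow_pos (by linarith) 2) (by nlinarith)
  have h00 : 0 < d2F Λ₁ Λ₂ (EuclideanSpace.single 1 a) 0 0 := by
    rw [d2F_eq_fst Λ₁ Λ₂ hz hz', (hasFDerivAt_gradFst_single Λ₁ ha).fderiv]
    have := mul_pos hc (mul_pos hΛ₁ (sub_pos.2 hinv))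
    simp only [smul_apply, PiLp.proj_apply, PiLp.single_apply, smul_eq_mul, if_true]
    linarith
  have h11 : d2F Λ₁ Λ₂ (EuclideanSpace.single 1 a) 1 1 < 0 := by
    rw [d2F_eq_snd Λ₁ Λ₂ hz hz', (hasFDerivAt_gradSnd_single Λ₁ Λ₂ ha).fderiv]
    have hq := (hroot (by linarith)).2 (Eq.refl a)
    have h1 : 0 < a - 1 := by linarith
    have h2 : 0 < a + 1 := by linarith
    have h3 : 0 < a := by linarith
    have hΛ : Λ₂ = 4 * Λ₁ * a / ((a - 1) * (a + 1)) := by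
      rw [eq_div_iff (by positivity)]
      linear_combination hq
    have hval : -Λ₂ * (a ^ 2)⁻¹ + Λ₁ * (2 * (((a - 1) ^ 2)⁻¹ - ((a + 1) ^ 2)⁻¹)) =
        4 * Λ₁ * (a ^ 2 + 1) / (a * ((a - 1) * (a + 1)) ^ 2) := by
      rw [hΛ]
      field_simp
      ring
    have hpos : 0 < 4 * Λ₁ * (a ^ 2 + 1) / (a * ((a - 1) * (a + 1)) ^ 2) := by positivity
    have := mul_pos hc hpos
    rw [hval]
    simp only [smul_apply, PiLp.proj_apply, PiLp.single_apply, smul_eq_mul, if_true]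
    linarith
  have h01 : d2F Λ₁ Λ₂ (EuclideanSpace.single 1 a) 0 1 = 0 := by
    rw [d2F_eq_snd Λ₁ Λ₂ hz hz', (hasFDerivAt_gradSnd_single Λ₁ Λ₂ ha).fderiv]
    simp
  refine ⟨hcrit, (hcrit _ hz hz').2 rfl, h00, h11, h01, ?_⟩
  simp only [Matrix.det_fin_two, Matrix.of_apply, h01, zero_mul, sub_zero]
  exact mul_neg_of_pos_of_neg h00 h11

end
end

section
/- For ε ∈ (0,1) define F̃_ε(w̃, z̃) = −(τ/(τ+1))·(τ·log w̃ + log(−z̃)) + τ·log(w̃ − z̃) − ( τ·log w̃ + log(−z̃) + 2π·((τ² + τ + 1)/(τ+1))·R₀ )² / ( 2·(log ε + 2πR₀) ) for w̃ > 0 and z̃ < 0. There exists ε₀ ∈ (0,1) such that for every ε ∈ (0, ε₀): F̃_ε has exactly one critical point on {(w̃, z̃) : w̃ > 0, z̃ < 0}, namely (w̃₀, z̃₀) = (C_τ, −C_τ/τ), and the 2×2 Hessian matrix of F̃_ε at this point is positive definite; in particular (w̃₀, z̃₀) is a nondegenerate local minimum of F̃_ε. -/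
open Real

noncomputable section

/-- `C_τ = τ^{1/(1+τ)} exp(−2πR₀(τ²+τ+1)/(1+τ)²)`. -/
def Ctau (τ R₀ : ℝ) : ℝ :=
  τ ^ ((1 : ℝ) / (1 + τ)) * Real.exp (-(2 * π * R₀ * (τ ^ 2 + τ + 1)) / (1 + τ) ^ 2)

/-- The function `F̃_ε` on `{w̃ > 0, z̃ < 0}`. -/
def Ftil (τ R₀ ε : ℝ) (p : ℝ × ℝ) : ℝ :=
  -(τ / (τ + 1)) * (τ * Real.log p.1 + Real.log (-p.2))
    + τ * Real.log (p.1 - p.2)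
    - (τ * Real.log p.1 + Real.log (-p.2) + 2 * π * ((τ ^ 2 + τ + 1) / (τ + 1)) * R₀) ^ 2
      / (2 * (Real.log ε + 2 * π * R₀))

/-- Basis of `ℝ × ℝ`. -/
def bR2 : Fin 2 → ℝ × ℝ := ![(1, 0), (0, 1)]

/-- Hessian matrix of `f : ℝ × ℝ → ℝ` at `p`. -/
def hessR2 (f : ℝ × ℝ → ℝ) (p : ℝ × ℝ) : Matrix (Fin 2) (Fin 2) ℝ :=
  Matrix.of fun i j : Fin 2 => fderiv ℝ (fun q => fderiv ℝ f q (bR2 j)) p (bR2 i)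

/-- The quantity squared in the last term of `Ftil`. -/
def logDefect (τ R₀ : ℝ) (p : ℝ × ℝ) : ℝ :=
  τ * Real.log p.1 + Real.log (-p.2) + 2 * π * ((τ ^ 2 + τ + 1) / (τ + 1)) * R₀

/-- The partial derivative of `Ftil` in the first variable, on `{w > 0, z < 0}`. -/
def partialFst (τ R₀ L : ℝ) (p : ℝ × ℝ) : ℝ :=
  -(τ ^ 2 / (τ + 1)) * p.1⁻¹ + τ * (p.1 - p.2)⁻¹ - logDefect τ R₀ p * (τ / L) * p.1⁻¹

/-- The partial derivative of `Ftil` in the second variable, on `{w > 0, z < 0}`. -/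
def partialSnd (τ R₀ L : ℝ) (p : ℝ × ℝ) : ℝ :=
  -(τ / (τ + 1)) * p.2⁻¹ - τ * (p.1 - p.2)⁻¹ - logDefect τ R₀ p * (1 / L) * p.2⁻¹

theorem hasFDerivAt_logDefect (τ R₀ : ℝ) {p : ℝ × ℝ} (hw : 0 < p.1) (hz : p.2 < 0) :
    HasFDerivAt (logDefect τ R₀)
      ((τ * p.1⁻¹) • ContinuousLinearMap.fst ℝ ℝ ℝ + p.2⁻¹ • ContinuousLinearMap.snd ℝ ℝ ℝ) p := by
  have h1 := (hasFDerivAt_fst (𝕜 := ℝ) (p := p)).log hw.ne'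
  have h2 := (hasFDerivAt_snd (𝕜 := ℝ) (p := p)).neg.log (by simpa using hz.ne)
  refine (((h1.const_mul τ).add h2).add_const
    (2 * π * ((τ ^ 2 + τ + 1) / (τ + 1)) * R₀)).congr_fderiv ?_
  ext <;> simp [inv_neg]

theorem hasFDerivAt_Ftil (τ R₀ ε : ℝ) (hL : Real.log ε + 2 * π * R₀ ≠ 0)
    {p : ℝ × ℝ} (hw : 0 < p.1) (hz : p.2 < 0) :
    HasFDerivAt (Ftil τ R₀ ε)
      (partialFst τ R₀ (Real.log ε + 2 * π * R₀) p • ContinuousLinearMap.fst ℝ ℝ ℝ +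
        partialSnd τ R₀ (Real.log ε + 2 * π * R₀) p • ContinuousLinearMap.snd ℝ ℝ ℝ) p := by
  have h1 := (hasFDerivAt_fst (𝕜 := ℝ) (p := p)).log hw.ne'
  have h2 := (hasFDerivAt_snd (𝕜 := ℝ) (p := p)).neg.log (by simpa using hz.ne)
  have h3 := ((hasFDerivAt_fst (𝕜 := ℝ) (p := p)).sub (hasFDerivAt_snd (𝕜 := ℝ) (p := p))).log
    (sub_pos.2 (hz.trans hw)).ne'
  have h4 := ((hasFDerivAt_logDefect τ R₀ hw hz).pow 2).mul_const
    (2 * (Real.log ε + 2 * π * R₀))⁻¹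
  refine (((((h1.const_mul τ).add h2).const_mul (-(τ / (τ + 1)))).add
    (h3.const_mul τ)).sub h4).congr_fderiv ?_
  generalize Real.log ε + 2 * π * R₀ = L at *
  ext
  · simp [partialFst]
    field_simp
  · simp [partialSnd, inv_neg]
    field_simp
    ring

theorem fderiv_Ftil_eq_zero_iff (τ R₀ ε : ℝ) (hL : Real.log ε + 2 * π * R₀ ≠ 0)
    {p : ℝ × ℝ} (hw : 0 < p.1) (hz : p.2 < 0) :
    fderiv ℝ (Ftil τ R₀ ε) p = 0 ↔
      partialFst τ R₀ (Real.log ε + 2 * π * R₀) p = 0 ∧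
        partialSnd τ R₀ (Real.log ε + 2 * π * R₀) p = 0 := by
  rw [(hasFDerivAt_Ftil τ R₀ ε hL hw hz).fderiv]
  constructor
  · intro h
    exact ⟨by simpa using DFunLike.congr_fun h (1, 0), by simpa using DFunLike.congr_fun h (0, 1)⟩
  · rintro ⟨h1, h2⟩
    simp [h1, h2]

theorem Ctau_pos {τ : ℝ} (R₀ : ℝ) (hτ : 0 < τ) : 0 < Ctau τ R₀ := by
  unfold Ctau
  positivity

theorem log_Ctau {τ : ℝ} (R₀ : ℝ) (hτ : 0 < τ) :
    Real.log (Ctau τ R₀) =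
      1 / (1 + τ) * Real.log τ - 2 * π * R₀ * (τ ^ 2 + τ + 1) / (1 + τ) ^ 2 := by
  rw [Ctau, Real.log_mul (Real.rpow_pos_of_pos hτ _).ne' (Real.exp_pos _).ne', Real.log_exp,
    Real.log_rpow hτ]
  ring

theorem logDefect_neg_div_eq {τ : ℝ} (R₀ : ℝ) (hτ : 0 < τ) {w : ℝ} (hw : 0 < w) :
    logDefect τ R₀ (w, -w / τ) = (τ + 1) * (Real.log w - Real.log (Ctau τ R₀)) := by
  have h : -(-w / τ) = w / τ := by ring
  rw [logDefect, log_Ctau R₀ hτ]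
  simp only [h]
  rw [Real.log_div hw.ne' hτ.ne']
  field_simp
  ring

theorem logDefect_Ctau {τ : ℝ} (R₀ : ℝ) (hτ : 0 < τ) :
    logDefect τ R₀ (Ctau τ R₀, -(Ctau τ R₀) / τ) = 0 := by
  rw [logDefect_neg_div_eq R₀ hτ (Ctau_pos R₀ hτ), sub_self, mul_zero]

theorem partials_eq_zero_iff {τ : ℝ} (R₀ : ℝ) (hτ : 0 < τ) {L : ℝ} (hL : L ≠ 0)
    {w z : ℝ} (hw : 0 < w) (hz : z < 0) :
    (partialFst τ R₀ L (w, z) = 0 ∧ partialSnd τ R₀ L (w, z) = 0) ↔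
      (w, z) = (Ctau τ R₀, -(Ctau τ R₀) / τ) := by
  have hwz : w - z ≠ 0 := (sub_pos.2 (hz.trans hw)).ne'
  have hz' := hz.ne
  constructor
  · rintro ⟨h1, h2⟩
    have hu : logDefect τ R₀ (w, z) = 0 := by
      have h : w * partialFst τ R₀ L (w, z) + z * partialSnd τ R₀ L (w, z) =
          -((τ + 1) / L) * logDefect τ R₀ (w, z) := by
        simp only [partialFst, partialSnd]
        field_simp
        ring
      rw [h1, h2, mul_zero, mul_zero, add_zero] at h
      exact (mul_eq_zero.1 h.symm).resolve_left (neg_ne_zero.2 (by positivity))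
    have hzw : z = -w / τ := by
      simp only [partialFst, hu, zero_mul, sub_zero] at h1
      field_simp at h1 ⊢
      have h : τ * (τ * z + w) = 0 := by linarith
      exact eq_neg_of_add_eq_zero_left ((mul_eq_zero.1 h).resolve_left hτ.ne')
    subst hzw
    rw [logDefect_neg_div_eq R₀ hτ hw] at hu
    have hlog : Real.log w = Real.log (Ctau τ R₀) :=
      sub_eq_zero.1 ((mul_eq_zero.1 hu).resolve_left (by positivity))
    rw [Real.log_injOn_pos hw (Ctau_pos R₀ hτ) hlog]
  · intro h
    have hu : logDefect τ R₀ (w, z) = 0 := by rw [h, logDefect_Ctau R₀ hτ]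
    have hzw : z = -w / τ := by
      rw [Prod.mk.injEq] at h
      rw [h.1, h.2]
    have hs : w - -w / τ = w * (τ + 1) / τ := by
      field_simp
      ring
    constructor
    · simp only [partialFst, hu]
      simp only [hzw, hs]
      field_simp
      ring
    · simp only [partialSnd, hu]
      simp only [hzw, hs]
      field_simp
      ring

theorem hasFDerivAt_inv_sub {p : ℝ × ℝ} (h : p.1 - p.2 ≠ 0) :
    HasFDerivAt (fun q : ℝ × ℝ => (q.1 - q.2)⁻¹)
      (-((p.1 - p.2) ^ 2)⁻¹ •
        (ContinuousLinearMap.fst ℝ ℝ ℝ - ContinuousLinearMap.snd ℝ ℝ ℝ)) p :=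
  (hasDerivAt_inv h).comp_hasFDerivAt p (hasFDerivAt_fst.sub hasFDerivAt_snd)

theorem hasFDerivAt_partialFst (τ R₀ L : ℝ) {p : ℝ × ℝ} (hw : 0 < p.1) (hz : p.2 < 0)
    (hu : logDefect τ R₀ p = 0) :
    HasFDerivAt (partialFst τ R₀ L)
      ((τ ^ 2 / (τ + 1) * (p.1 ^ 2)⁻¹ - τ * ((p.1 - p.2) ^ 2)⁻¹ - τ ^ 2 / L * (p.1 ^ 2)⁻¹) •
          ContinuousLinearMap.fst ℝ ℝ ℝ +
        (τ * ((p.1 - p.2) ^ 2)⁻¹ - τ / L * (p.1⁻¹ * p.2⁻¹)) •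
          ContinuousLinearMap.snd ℝ ℝ ℝ) p := by
  have h1 := (hasDerivAt_inv hw.ne').comp_hasFDerivAt p (hasFDerivAt_fst (𝕜 := ℝ) (p := p))
  have h2 := hasFDerivAt_inv_sub (sub_pos.2 (hz.trans hw)).ne'
  have h3 := ((hasFDerivAt_logDefect τ R₀ hw hz).mul_const (τ / L)).mul h1
  refine (((h1.const_mul (-(τ ^ 2 / (τ + 1)))).add (h2.const_mul τ)).sub h3).congr_fderiv ?_
  ext
  · simp [hu]
    ring
  · simp [hu]
    ring

theorem hasFDerivAt_partialSnd (τ R₀ L : ℝ) {p : ℝ × ℝ} (hw : 0 < p.1) (hz : p.2 < 0)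
    (hu : logDefect τ R₀ p = 0) :
    HasFDerivAt (partialSnd τ R₀ L)
      ((τ * ((p.1 - p.2) ^ 2)⁻¹ - τ / L * (p.1⁻¹ * p.2⁻¹)) •
          ContinuousLinearMap.fst ℝ ℝ ℝ +
        (τ / (τ + 1) * (p.2 ^ 2)⁻¹ - τ * ((p.1 - p.2) ^ 2)⁻¹ - 1 / L * (p.2 ^ 2)⁻¹) •
          ContinuousLinearMap.snd ℝ ℝ ℝ) p := by
  have h1 := (hasDerivAt_inv hz.ne).comp_hasFDerivAt p (hasFDerivAt_snd (𝕜 := ℝ) (p := p))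
  have h2 := hasFDerivAt_inv_sub (sub_pos.2 (hz.trans hw)).ne'
  have h3 := ((hasFDerivAt_logDefect τ R₀ hw hz).mul_const (1 / L)).mul h1
  refine (((h1.const_mul (-(τ / (τ + 1)))).sub (h2.const_mul τ)).sub h3).congr_fderiv ?_
  ext
  · simp [hu]
    ring
  · simp [hu]
    ring

theorem eventually_quadrant {p : ℝ × ℝ} (hw : 0 < p.1) (hz : p.2 < 0) :
    ∀ᶠ q : ℝ × ℝ in nhds p, 0 < q.1 ∧ q.2 < 0 :=
  (continuous_fst.continuousAt.eventually (lt_mem_nhds hw)).and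
    (continuous_snd.continuousAt.eventually (gt_mem_nhds hz))

theorem hessR2_Ftil (τ R₀ ε : ℝ) (hL : Real.log ε + 2 * π * R₀ ≠ 0)
    {p : ℝ × ℝ} (hw : 0 < p.1) (hz : p.2 < 0) (hu : logDefect τ R₀ p = 0) :
    hessR2 (Ftil τ R₀ ε) p =
      let L := Real.log ε + 2 * π * R₀
      !![τ ^ 2 / (τ + 1) * (p.1 ^ 2)⁻¹ - τ * ((p.1 - p.2) ^ 2)⁻¹ - τ ^ 2 / L * (p.1 ^ 2)⁻¹,
          τ * ((p.1 - p.2) ^ 2)⁻¹ - τ / L * (p.1⁻¹ * p.2⁻¹);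
        τ * ((p.1 - p.2) ^ 2)⁻¹ - τ / L * (p.1⁻¹ * p.2⁻¹),
          τ / (τ + 1) * (p.2 ^ 2)⁻¹ - τ * ((p.1 - p.2) ^ 2)⁻¹ - 1 / L * (p.2 ^ 2)⁻¹] := by
  have e0 : (fun q => fderiv ℝ (Ftil τ R₀ ε) q (bR2 0)) =ᶠ[nhds p]
      partialFst τ R₀ (Real.log ε + 2 * π * R₀) := by
    filter_upwards [eventually_quadrant hw hz] with q hq
    simp [(hasFDerivAt_Ftil τ R₀ ε hL hq.1 hq.2).fderiv, bR2]
  have e1 : (fun q => fderiv ℝ (Ftil τ R₀ ε) q (bR2 1)) =ᶠ[nhds p]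
      partialSnd τ R₀ (Real.log ε + 2 * π * R₀) := by
    filter_upwards [eventually_quadrant hw hz] with q hq
    simp [(hasFDerivAt_Ftil τ R₀ ε hL hq.1 hq.2).fderiv, bR2]
  have d0 := e0.fderiv_eq.trans (hasFDerivAt_partialFst τ R₀ _ hw hz hu).fderiv
  have d1 := e1.fderiv_eq.trans (hasFDerivAt_partialSnd τ R₀ _ hw hz hu).fderiv
  ext i j
  fin_cases i <;> fin_cases j <;> simp [hessR2, d0, d1] <;> simp [bR2]

theorem posDef_fin_two {a b d : ℝ} (ha : 0 < a) (hdet : 0 < a * d - b ^ 2) :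
    (!![a, b; b, d] : Matrix (Fin 2) (Fin 2) ℝ).PosDef := by
  refine Matrix.PosDef.of_dotProduct_mulVec_pos ?_ ?_
  · ext i j
    fin_cases i <;> fin_cases j <;> simp
  · intro x hx
    have hne : x 0 ≠ 0 ∨ x 1 ≠ 0 := by
      by_contra! h
      exact hx (by ext i; fin_cases i <;> simp [h.1, h.2])
    have hpos : 0 < (a * x 0 + b * x 1) ^ 2 + (a * d - b ^ 2) * x 1 ^ 2 := by
      by_cases h1 : x 1 = 0
      · have h0 : x 0 ≠ 0 := hne.resolve_right (not_not.2 h1)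
        rw [h1]
        simp only [mul_zero, add_zero]
        positivity
      · positivity
    have heq : a * (star x ⬝ᵥ !![a, b; b, d].mulVec x) =
        (a * x 0 + b * x 1) ^ 2 + (a * d - b ^ 2) * x 1 ^ 2 := by
      simp [Matrix.mulVec, dotProduct, Fin.sum_univ_two]
      ring
    exact pos_of_mul_pos_right (heq ▸ hpos) ha.le

theorem hessR2_Ftil_posDef {τ : ℝ} (R₀ : ℝ) (hτ : 0 < τ) {ε : ℝ}
    (hL : Real.log ε + 2 * π * R₀ < 0) :
    (hessR2 (Ftil τ R₀ ε) (Ctau τ R₀, -(Ctau τ R₀) / τ)).PosDef := by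
  have hC := Ctau_pos R₀ hτ
  rw [hessR2_Ftil τ R₀ ε hL.ne hC (div_neg_of_neg_of_pos (neg_neg_of_pos hC) hτ)
    (logDefect_Ctau R₀ hτ)]
  generalize Ctau τ R₀ = C at *
  obtain ⟨m, hm, hLm⟩ : ∃ m : ℝ, 0 < m ∧ Real.log ε + 2 * π * R₀ = -m⁻¹ :=
    ⟨-(Real.log ε + 2 * π * R₀)⁻¹, neg_pos.2 (inv_lt_zero.2 hL), by simp [inv_neg]⟩
  have hs : C - -C / τ = C * (τ + 1) / τ := by
    field_simp
    ring
  simp only [hLm, hs]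
  have h00 : τ ^ 2 / (τ + 1) * (C ^ 2)⁻¹ - τ * ((C * (τ + 1) / τ) ^ 2)⁻¹ -
      τ ^ 2 / -m⁻¹ * (C ^ 2)⁻¹ = (τ / C) ^ 2 * (1 / (τ + 1) ^ 2 + m) := by
    field_simp
    ring
  have h01 : τ * ((C * (τ + 1) / τ) ^ 2)⁻¹ - τ / -m⁻¹ * (C⁻¹ * (-C / τ)⁻¹) =
      (τ / C) ^ 2 * (τ / (τ + 1) ^ 2 - m) := by
    field_simp
  have h11 : τ / (τ + 1) * ((-C / τ) ^ 2)⁻¹ - τ * ((C * (τ + 1) / τ) ^ 2)⁻¹ -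
      1 / -m⁻¹ * ((-C / τ) ^ 2)⁻¹ = (τ / C) ^ 2 * (τ ^ 2 / (τ + 1) ^ 2 + m) := by
    field_simp
    ring
  rw [h00, h01, h11]
  refine posDef_fin_two (by positivity) ?_
  have hdet : (τ / C) ^ 2 * (1 / (τ + 1) ^ 2 + m) * ((τ / C) ^ 2 * (τ ^ 2 / (τ + 1) ^ 2 + m)) -
      ((τ / C) ^ 2 * (τ / (τ + 1) ^ 2 - m)) ^ 2 = (τ / C) ^ 4 * m := by
    field_simp
    ring
  rw [hdet]
  positivity

/-- Weighted arithmetic-geometric mean inequality with weights `τ / (τ + 1)` and `1 / (τ + 1)`. -/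
theorem log_add_one_sub_le {τ w y : ℝ} (hτ : 0 < τ) (hw : 0 < w) (hy : 0 < y) :
    Real.log (τ + 1) - τ / (τ + 1) * Real.log τ ≤
      Real.log (w + y) - 1 / (τ + 1) * (τ * Real.log w + Real.log y) := by
  have h1 := Real.log_le_sub_one_of_pos (x := w * (τ + 1) / ((w + y) * τ)) (by positivity)
  have h2 := Real.log_le_sub_one_of_pos (x := y * (τ + 1) / (w + y)) (by positivity)
  rw [Real.log_div (by positivity) (by positivity), Real.log_mul (by positivity) (by positivity),
    Real.log_mul (by positivity) (by positivity)] at h1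
  rw [Real.log_div (by positivity) (by positivity),
    Real.log_mul (by positivity) (by positivity)] at h2
  have h3 := add_le_add (mul_le_mul_of_nonneg_left h1 hτ.le) h2
  have h4 : τ * (w * (τ + 1) / ((w + y) * τ) - 1) + (y * (τ + 1) / (w + y) - 1) = 0 := by
    field_simp
    ring
  rw [h4] at h3
  field_simp
  linarith

theorem Ftil_Ctau_le {τ : ℝ} (R₀ : ℝ) (hτ : 0 < τ) {ε : ℝ}
    (hL : Real.log ε + 2 * π * R₀ < 0) {p : ℝ × ℝ} (hw : 0 < p.1) (hz : p.2 < 0) :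
    Ftil τ R₀ ε (Ctau τ R₀, -(Ctau τ R₀) / τ) ≤ Ftil τ R₀ ε p := by
  have hFtil : ∀ q : ℝ × ℝ, Ftil τ R₀ ε q =
      τ * (Real.log (q.1 - q.2) - 1 / (τ + 1) * (τ * Real.log q.1 + Real.log (-q.2))) -
        logDefect τ R₀ q ^ 2 / (2 * (Real.log ε + 2 * π * R₀)) := by
    intro q
    rw [Ftil, logDefect]
    ring
  rw [hFtil, hFtil, logDefect_Ctau R₀ hτ]
  have hC := Ctau_pos R₀ hτ
  generalize Ctau τ R₀ = C at *
  have hs : C - -C / τ = C * (τ + 1) / τ := by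
    field_simp
    ring
  have hn : -(-C / τ) = C / τ := by ring
  have hmin : Real.log (C - -C / τ) - 1 / (τ + 1) * (τ * Real.log C + Real.log (-(-C / τ))) =
      Real.log (τ + 1) - τ / (τ + 1) * Real.log τ := by
    rw [hs, hn, Real.log_div (by positivity) hτ.ne', Real.log_mul hC.ne' (by positivity),
      Real.log_div hC.ne' hτ.ne']
    field_simp
    ring
  have hle := mul_le_mul_of_nonneg_left (log_add_one_sub_le hτ hw (neg_pos.2 hz)) hτ.le
  rw [← sub_eq_add_neg] at hle
  have hsq : logDefect τ R₀ p ^ 2 / (2 * (Real.log ε + 2 * π * R₀)) ≤ 0 :=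
    div_nonpos_of_nonneg_of_nonpos (sq_nonneg _) (by linarith)
  simp only [hmin]
  rw [zero_pow two_ne_zero, zero_div]
  linarith

theorem stmt_5 (τ R₀ : ℝ) (hτ : 0 < τ) :
    ∃ ε₀ ∈ Set.Ioo (0 : ℝ) 1, ∀ ε ∈ Set.Ioo (0 : ℝ) ε₀,
      -- exactly one critical point, namely (C_τ, −C_τ/τ)
      (∀ w z : ℝ, 0 < w → z < 0 →
        (fderiv ℝ (Ftil τ R₀ ε) (w, z) = 0 ↔ (w, z) = (Ctau τ R₀, -(Ctau τ R₀) / τ))) ∧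
      fderiv ℝ (Ftil τ R₀ ε) (Ctau τ R₀, -(Ctau τ R₀) / τ) = 0 ∧
      -- positive definite Hessian
      (hessR2 (Ftil τ R₀ ε) (Ctau τ R₀, -(Ctau τ R₀) / τ)).PosDef ∧
      -- nondegenerate local minimum
      IsLocalMin (Ftil τ R₀ ε) (Ctau τ R₀, -(Ctau τ R₀) / τ) := by
  refine ⟨min (1 / 2) (Real.exp (-(2 * π * R₀))), ⟨by positivity, ?_⟩, ?_⟩
  · exact (min_le_left _ _).trans_lt (by norm_num)
  · rintro ε ⟨hε, hlt⟩
    have hL : Real.log ε + 2 * π * R₀ < 0 := by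
      have h := Real.log_lt_log hε (hlt.trans_le (min_le_right _ _))
      rw [Real.log_exp] at h
      linarith
    have hC := Ctau_pos R₀ hτ
    have hz : -(Ctau τ R₀) / τ < 0 := div_neg_of_neg_of_pos (neg_neg_of_pos hC) hτ
    have hcrit : ∀ w z : ℝ, 0 < w → z < 0 →
        (fderiv ℝ (Ftil τ R₀ ε) (w, z) = 0 ↔ (w, z) = (Ctau τ R₀, -(Ctau τ R₀) / τ)) :=
      fun w z hw hz =>
        (fderiv_Ftil_eq_zero_iff τ R₀ ε hL.ne hw hz).trans
          (partials_eq_zero_iff R₀ hτ hL.ne hw hz)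
    refine ⟨hcrit, (hcrit _ _ hC hz).2 rfl, hessR2_Ftil_posDef R₀ hτ hL, ?_⟩
    filter_upwards [eventually_quadrant (p := (Ctau τ R₀, -(Ctau τ R₀) / τ)) hC hz] with q hq
    exact Ftil_Ctau_le R₀ hτ hL hq.1 hq.2

end
end

section
/- Let ε ∈ (0,1) satisfy log ε + 2πR₀ ≠ 0, and define F_ε(w,z) = −(τ/(τ+1))·(τ·log|w| + log|z|) + τ·log|w − z| − ( τ·log|w| + log|z| + 2π·((τ² + τ + 1)/(τ+1))·R₀ )² / ( 2·(log ε + 2πR₀) ) for w, z ∈ ℝ² ∖ {0} with w ≠ z. Then the set of critical points of F_ε (points of the open domain where the gradient of F_ε with respect to (w,z) ∈ ℝ⁴ vanishes) is exactly { (w, −w/τ) : w ∈ ℝ², |w| = C_τ }. -/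
open Real

noncomputable section

/-- The function `F_ε` on pairs `(w, z)` of nonzero distinct points of `ℝ²`. -/
def Feps (τ R₀ ε : ℝ)
    (p : EuclideanSpace ℝ (Fin 2) × EuclideanSpace ℝ (Fin 2)) : ℝ :=
  -(τ / (τ + 1)) * (τ * Real.log ‖p.1‖ + Real.log ‖p.2‖)
    + τ * Real.log ‖p.1 - p.2‖
    - (τ * Real.log ‖p.1‖ + Real.log ‖p.2‖
        + 2 * π * ((τ ^ 2 + τ + 1) / (τ + 1)) * R₀) ^ 2
      / (2 * (Real.log ε + 2 * π * R₀))

section Gradient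

variable {E : Type*} [NormedAddCommGroup E] [InnerProductSpace ℝ E]

theorem hasFDerivAt_log_norm {x : E} (hx : x ≠ 0) :
    HasFDerivAt (fun y : E => Real.log ‖y‖) ((‖x‖ ^ 2)⁻¹ • innerSL ℝ x) x := by
  have hsq : HasFDerivAt (fun y : E => ‖y‖ ^ 2) (2 • innerSL ℝ x) x :=
    (hasStrictFDerivAt_norm_sq x).hasFDerivAt
  have hlog := (hsq.log (by positivity)).const_mul (1 / 2 : ℝ)
  have hfun : (fun y : E => Real.log ‖y‖) = fun y => 1 / 2 * Real.log (‖y‖ ^ 2) := by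
    funext y
    rw [Real.log_pow]
    push_cast
    ring
  rw [hfun]
  refine hlog.congr_fderiv (ContinuousLinearMap.ext fun u => ?_)
  simp
  ring

/-- Vanishing of the gradients of `m (τ log|w| + log|z|) + τ log|w - z|`, with `m` frozen,
forces `z = -w / τ` and determines `m`. -/
theorem balance_iff {τ m : ℝ} (hτ : 0 < τ) {w z : E} (hw : w ≠ 0) (hz : z ≠ 0) (hwz : w ≠ z) :
    ((m * τ * (‖w‖ ^ 2)⁻¹) • w + (τ * (‖w - z‖ ^ 2)⁻¹) • (w - z) = 0 ∧
      (m * (‖z‖ ^ 2)⁻¹) • z - (τ * (‖w - z‖ ^ 2)⁻¹) • (w - z) = 0) ↔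
      z = (-τ⁻¹) • w ∧ m = -(τ / (τ + 1)) := by
  have hw' : ‖w‖ ≠ 0 := norm_ne_zero_iff.mpr hw
  have hz' : ‖z‖ ≠ 0 := norm_ne_zero_iff.mpr hz
  have hd : w - z ≠ 0 := sub_ne_zero.mpr hwz
  have hd' : ‖w - z‖ ≠ 0 := norm_ne_zero_iff.mpr hd
  have hτ1 : τ + 1 ≠ 0 := by positivity
  have hdiff : z = (-τ⁻¹) • w → w - z = ((τ + 1) / τ) • w := by
    intro h
    rw [h, show (τ + 1) / τ = 1 + τ⁻¹ by field_simp]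
    module
  have hnorm : z = (-τ⁻¹) • w → ‖w - z‖ = ((τ + 1) / τ) * ‖w‖ := by
    intro h
    rw [hdiff h, norm_smul, Real.norm_of_nonneg (by positivity)]
  constructor
  · rintro ⟨h₁, h₂⟩
    have hm : m ≠ 0 := by
      rintro rfl
      simp [hτ.ne', hd, hd'] at h₁
    have hsum : m • ((τ * (‖w‖ ^ 2)⁻¹) • w + (‖z‖ ^ 2)⁻¹ • z) = 0 := by
      linear_combination (norm := module) h₁ + h₂
    have hcancel := (smul_eq_zero.mp hsum).resolve_left hm
    have hzw : (‖z‖ ^ 2)⁻¹ • z = -((τ * (‖w‖ ^ 2)⁻¹) • w) :=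
      eq_neg_of_add_eq_zero_right hcancel
    have hn : ‖w‖ = τ * ‖z‖ := by
      have h := congrArg norm hzw
      rw [norm_neg, norm_smul, norm_smul, Real.norm_of_nonneg (by positivity),
        Real.norm_of_nonneg (by positivity)] at h
      field_simp at h
      linarith
    have hzeq : z = (-τ⁻¹) • w := by
      have h := congrArg (fun v => (‖z‖ ^ 2) • v) hzw
      simp only [smul_neg, smul_smul] at h
      rw [mul_inv_cancel₀ (by positivity), one_smul, hn] at h
      rw [h, ← neg_smul]
      congr 1
      field_simp
    refine ⟨hzeq, ?_⟩
    rw [hnorm hzeq, hdiff hzeq, smul_smul, ← add_smul] at h₁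
    have h := (smul_eq_zero.mp h₁).resolve_right hw
    field_simp at h ⊢
    have h' : m * (τ + 1) + τ = 0 := by simpa [hτ.ne'] using h
    linarith
  · rintro ⟨hzeq, rfl⟩
    have hzn : ‖z‖ = τ⁻¹ * ‖w‖ := by
      rw [hzeq, norm_smul, norm_neg, Real.norm_of_nonneg (by positivity)]
    rw [hnorm hzeq, hdiff hzeq, hzn, smul_smul, ← add_smul, hzeq, smul_smul, ← sub_smul]
    constructor
    all_goals
      convert zero_smul ℝ w using 2
      field_simp
      ring

end Gradient

theorem hasFDerivAt_Feps (τ R₀ ε : ℝ) {w z : EuclideanSpace ℝ (Fin 2)}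
    (hL : Real.log ε + 2 * π * R₀ ≠ 0) (hw : w ≠ 0) (hz : z ≠ 0) (hwz : w ≠ z)
    {m : ℝ} (hm : m = -(τ / (τ + 1)) - (τ * Real.log ‖w‖ + Real.log ‖z‖
        + 2 * π * ((τ ^ 2 + τ + 1) / (τ + 1)) * R₀) / (Real.log ε + 2 * π * R₀)) :
    HasFDerivAt (Feps τ R₀ ε)
      ((innerSL ℝ ((m * τ * (‖w‖ ^ 2)⁻¹) • w + (τ * (‖w - z‖ ^ 2)⁻¹) • (w - z))).coprod
        (innerSL ℝ ((m * (‖z‖ ^ 2)⁻¹) • z - (τ * (‖w - z‖ ^ 2)⁻¹) • (w - z)))) (w, z) := by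
  have h₁ := (hasFDerivAt_log_norm hw).comp (w, z) (hasFDerivAt_fst (𝕜 := ℝ) (p := (w, z)))
  have h₂ := (hasFDerivAt_log_norm hz).comp (w, z) (hasFDerivAt_snd (𝕜 := ℝ) (p := (w, z)))
  have h₃ := (hasFDerivAt_log_norm (sub_ne_zero.mpr hwz)).comp (w, z)
    ((hasFDerivAt_fst (𝕜 := ℝ) (p := (w, z))).sub (hasFDerivAt_snd (𝕜 := ℝ) (p := (w, z))))
  have hS := (h₁.const_mul τ).add h₂
  have hF := ((hS.const_mul (-(τ / (τ + 1)))).add (h₃.const_mul τ)).sub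
    (((hS.add_const (2 * π * ((τ ^ 2 + τ + 1) / (τ + 1)) * R₀)).pow 2).mul_const
      (2 * (Real.log ε + 2 * π * R₀))⁻¹)
  refine hF.congr_fderiv ?_
  apply ContinuousLinearMap.ext
  rintro ⟨u, v⟩
  simp [hm]
  field_simp
  ring

theorem coprod_innerSL_eq_zero_iff {E : Type*} [NormedAddCommGroup E] [InnerProductSpace ℝ E]
    (a b : E) : (innerSL ℝ a).coprod (innerSL ℝ b) = 0 ↔ a = 0 ∧ b = 0 := by
  constructor
  · intro h
    have ha := DFunLike.congr_fun h (a, 0)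
    have hb := DFunLike.congr_fun h (0, b)
    simpa using And.intro ha hb
  · rintro ⟨rfl, rfl⟩
    ext <;> simp

theorem eq_Ctau_iff {τ : ℝ} (R₀ : ℝ) (hτ : 0 < τ) {r : ℝ} (hr : 0 < r) :
    r = Ctau τ R₀ ↔
      τ * Real.log r + Real.log (τ⁻¹ * r) + 2 * π * ((τ ^ 2 + τ + 1) / (τ + 1)) * R₀ = 0 := by
  have hC : 0 < Ctau τ R₀ := mul_pos (Real.rpow_pos_of_pos hτ _) (Real.exp_pos _)
  have hτ1 : τ + 1 ≠ 0 := by positivity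
  have hτ1' : 1 + τ ≠ 0 := by positivity
  rw [← Real.log_injOn_pos.eq_iff hr hC, Ctau,
    Real.log_mul (Real.rpow_pos_of_pos hτ _).ne' (Real.exp_pos _).ne', Real.log_rpow hτ,
    Real.log_exp, Real.log_mul (inv_ne_zero hτ.ne') hr.ne', Real.log_inv, add_comm τ 1]
  have hid : τ * Real.log r + (-Real.log τ + Real.log r)
        + 2 * π * ((τ ^ 2 + τ + 1) / (1 + τ)) * R₀
      = (1 + τ) * (Real.log r - (1 / (1 + τ) * Real.log τ
        + -(2 * π * R₀ * (τ ^ 2 + τ + 1)) / (1 + τ) ^ 2)) := by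
    field_simp
    ring
  rw [hid, mul_eq_zero, or_iff_right hτ1', sub_eq_zero]

theorem stmt_6 (τ R₀ : ℝ) (hτ : 0 < τ)
    (ε : ℝ) (hε : ε ∈ Set.Ioo (0 : ℝ) 1) (hL : Real.log ε + 2 * π * R₀ ≠ 0) :
    ∀ w z : EuclideanSpace ℝ (Fin 2), w ≠ 0 → z ≠ 0 → w ≠ z →
      (fderiv ℝ (Feps τ R₀ ε) (w, z) = 0 ↔ z = (-τ⁻¹) • w ∧ ‖w‖ = Ctau τ R₀) := by
  intro w z hw hz hwz
  rw [(hasFDerivAt_Feps τ R₀ ε hL hw hz hwz rfl).fderiv, coprod_innerSL_eq_zero_iff,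
    balance_iff hτ hw hz hwz]
  refine and_congr_right fun hzeq => ?_
  have hzn : ‖z‖ = τ⁻¹ * ‖w‖ := by
    rw [hzeq, norm_smul, norm_neg, Real.norm_of_nonneg (by positivity)]
  rw [sub_eq_self, div_eq_zero_iff, or_iff_left hL, hzn,
    eq_Ctau_iff R₀ hτ (norm_pos_iff.mpr hw)]

end
end

section
/- Let A, B ∈ ℝ² ∖ {0} with A ≠ B. Then the two vector equations −τ·A/((τ+1)·|A|²) + (A − B)/|A − B|² = 0 and −B/((τ+1)·|B|²) − (A − B)/|A − B|² = 0 hold simultaneously if and only if B = −A/τ. -/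
theorem stmt_8 (τ : ℝ) (hτ : 0 < τ)
    (A B : EuclideanSpace ℝ (Fin 2)) (hA : A ≠ 0) (hB : B ≠ 0) (hAB : A ≠ B) :
    ((-(τ / ((τ + 1) * ‖A‖ ^ 2))) • A + (‖A - B‖ ^ 2)⁻¹ • (A - B) = 0 ∧
      (-(1 / ((τ + 1) * ‖B‖ ^ 2))) • B - (‖A - B‖ ^ 2)⁻¹ • (A - B) = 0) ↔
    B = (-τ⁻¹) • A := by
  have hτ1 : τ + 1 ≠ 0 := by positivity
  have ha : ‖A‖ ≠ 0 := norm_ne_zero_iff.mpr hA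
  have hb : ‖B‖ ≠ 0 := norm_ne_zero_iff.mpr hB
  constructor
  · rintro ⟨h₁, h₂⟩
    have hsum : (-(τ / ((τ + 1) * ‖A‖ ^ 2))) • A + (-(1 / ((τ + 1) * ‖B‖ ^ 2))) • B = 0 := by
      rw [eq_neg_of_add_eq_zero_left h₁, sub_eq_zero.mp h₂, neg_add_cancel]
    obtain ⟨c, hc⟩ : ∃ c : ℝ, c = -(τ * ‖B‖ ^ 2 / ‖A‖ ^ 2) := ⟨_, rfl⟩
    have hBc : B = c • A := by
      have h := congrArg (fun v => ((τ + 1) * ‖B‖ ^ 2) • v) hsum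
      simp only [smul_add, smul_smul, smul_zero] at h
      have e₁ : (τ + 1) * ‖B‖ ^ 2 * -(τ / ((τ + 1) * ‖A‖ ^ 2)) = c := by
        rw [hc]; field_simp
      have e₂ : (τ + 1) * ‖B‖ ^ 2 * -(1 / ((τ + 1) * ‖B‖ ^ 2)) = -1 := by
        field_simp
      rw [e₁, e₂, neg_one_smul, ← sub_eq_add_neg, sub_eq_zero] at h
      exact h.symm
    have hc0 : c ≠ 0 := by
      rintro rfl
      exact hB (by rw [hBc, zero_smul])
    have hnorm : ‖B‖ ^ 2 = c ^ 2 * ‖A‖ ^ 2 := by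
      rw [hBc, norm_smul, mul_pow, Real.norm_eq_abs, sq_abs]
    have hquad : c = -(τ * c ^ 2) := by
      rw [hnorm] at hc
      field_simp at hc
      linear_combination c * hc
    have hcτ : c = -τ⁻¹ := by
      have h : c * (1 + τ * c) = 0 := by linear_combination hquad
      have h' := (mul_eq_zero.mp h).resolve_left hc0
      field_simp
      linarith
    rw [hBc, hcτ]
  · intro h
    have hsub : A - B = (1 + τ⁻¹) • A := by
      rw [h]; module
    have hnB : ‖B‖ ^ 2 = (τ⁻¹) ^ 2 * ‖A‖ ^ 2 := by
      rw [h, norm_smul, mul_pow, Real.norm_eq_abs, sq_abs, neg_sq]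
    have hnsub : ‖A - B‖ ^ 2 = (1 + τ⁻¹) ^ 2 * ‖A‖ ^ 2 := by
      rw [hsub, norm_smul, mul_pow, Real.norm_eq_abs, sq_abs]
    have hpos : 1 + τ⁻¹ ≠ 0 := by positivity
    rw [hnsub, hnB, hsub, h, smul_smul, smul_smul, ← add_smul, ← sub_smul]
    constructor
    · convert zero_smul ℝ A using 2
      field_simp
      ring
    · convert zero_smul ℝ A using 2
      field_simp
      ring
end

section
/- There exists ε₀ ∈ (0,1) such that for every ε ∈ (0, ε₀), the function r ↦ (log r)/r − c·log ε has exactly one zero in the open interval ( 1/|log ε| , 1/√|log ε| ). -/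
theorem strictMonoOn_log_add_mul {a : ℝ} (ha : 0 ≤ a) :
    StrictMonoOn (fun r : ℝ => Real.log r + a * r) (Set.Ioi 0) :=
  Real.strictMonoOn_log.add_monotone fun _ _ _ _ h => mul_le_mul_of_nonneg_left h ha

theorem eventually_log_lt_mul {c : ℝ} (hc : 0 < c) :
    ∀ᶠ x : ℝ in Filter.atTop, Real.log x < c * x := by
  filter_upwards [Real.isLittleO_log_id_atTop.bound (half_pos hc), Filter.eventually_gt_atTop 0]
    with x hx hx0
  rw [id, Real.norm_of_nonneg hx0.le] at hx
  have := mul_pos hc hx0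
  linarith [Real.le_norm_self (Real.log x)]

theorem existsUnique_log_add_mul_eq_zero {c L : ℝ} (hc : 0 < c) (hL : 1 < L)
    (hlow : c < Real.log L) (hupp : Real.log √L < c * √L) :
    ∃! r : ℝ, r ∈ Set.Ioo (1 / L) (1 / √L) ∧ Real.log r + c * L * r = 0 := by
  have hL0 : 0 < L := one_pos.trans hL
  have hs0 : 0 < √L := Real.sqrt_pos.2 hL0
  have hle : 1 / L ≤ 1 / √L :=
    one_div_le_one_div_of_le hs0 (Real.sqrt_le_left hL0.le |>.2 (by nlinarith))
  have hpos : ∀ r ∈ Set.Icc (1 / L) (1 / √L), 0 < r := fun r hr =>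
    (one_div_pos.2 hL0).trans_le hr.1
  have hcont : ContinuousOn (fun r : ℝ => Real.log r + c * L * r)
      (Set.Icc (1 / L) (1 / √L)) :=
    (Real.continuousOn_log.mono fun r hr => (hpos r hr).ne').add (by fun_prop)
  have hleft : Real.log (1 / L) + c * L * (1 / L) < 0 := by
    rw [one_div, Real.log_inv, mul_assoc, mul_inv_cancel₀ hL0.ne']
    linarith
  have hright : 0 < Real.log (1 / √L) + c * L * (1 / √L) := by
    rw [mul_assoc, mul_one_div, Real.div_sqrt, one_div, Real.log_inv]
    linarith
  obtain ⟨r, hr, hr0⟩ := intermediate_value_Ioo hle hcont ⟨hleft, hright⟩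
  refine ⟨r, ⟨hr, hr0⟩, fun s hs => ?_⟩
  exact (strictMonoOn_log_add_mul (mul_pos hc hL0).le).injOn
    (hpos s (Set.Ioo_subset_Icc_self hs.1)) (hpos r (Set.Ioo_subset_Icc_self hr))
    (hs.2.trans hr0.symm)

theorem stmt_9 (c : ℝ) (hc : 0 < c) :
    ∃ ε₀ ∈ Set.Ioo (0 : ℝ) 1, ∀ ε ∈ Set.Ioo (0 : ℝ) ε₀,
      ∃! r : ℝ, r ∈ Set.Ioo (1 / |Real.log ε|) (1 / Real.sqrt |Real.log ε|) ∧
        Real.log r / r - c * Real.log ε = 0 := by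
  obtain ⟨M, hM⟩ := Filter.eventually_atTop.1
    ((Real.tendsto_log_atTop.eventually_gt_atTop c).and
      (Real.tendsto_sqrt_atTop.eventually (eventually_log_lt_mul hc)))
  refine ⟨Real.exp (-max M 1), ⟨Real.exp_pos _, Real.exp_lt_one_iff.2 (by simp)⟩, fun ε hε => ?_⟩
  have hlog : Real.log ε < -max M 1 := (Real.log_lt_iff_lt_exp hε.1).2 hε.2
  have hM1 := le_max_left M 1
  have h1M := le_max_right M 1
  have habs : |Real.log ε| = -Real.log ε := abs_of_neg (by linarith)
  have hL : 1 < |Real.log ε| := by linarith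
  obtain ⟨hlow, hupp⟩ := hM |Real.log ε| (by linarith)
  refine (existsUnique_congr fun r => and_congr_right fun hr => ?_).1
    (existsUnique_log_add_mul_eq_zero hc hL hlow hupp)
  have hr0 : 0 < r := (one_div_pos.2 (one_pos.trans hL)).trans hr.1
  rw [sub_eq_zero, div_eq_iff hr0.ne', habs]
  constructor <;> intro h <;> linarith
end
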